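/- Let X be a compact metric space and F : X → Set X a set-valued map with nonempty compact values that is upper semicontinuous. Suppose there exist T ∈ ℕ with T ≥ 1 and ε > 0 such that for every x ∈ X the set F^T({x}) contains an open ball of radius ε. Then the collection of minimal F-invariant sets is finite. -/

import Mathlib

open Metric Set Filter Topology

/-- The extension of a set-valued map to subsets: `F(A) = ⋃_{x ∈ A} F(x)`. -/
def setImage {X : Type*} (F : X → Set X) (A : Set X) : Set X := ⋃ x ∈ A, F x

/-- A nonempty compact set `M` is a minimal `F`-invariant set if `F(M) = M` and no
proper nonempty compact subset of `M` is `F`-invariant. -/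
def IsMinimalInvariant {X : Type*} [MetricSpace X] (F : X → Set X) (M : Set X) : Prop :=
  M.Nonempty ∧ IsCompact M ∧ setImage F M = M ∧
    ∀ M' : Set X, M' ⊂ M → M'.Nonempty → IsCompact M' → setImage F M' ≠ M'

/-- The sequential closed-graph form of upper semicontinuity for a set-valued map. -/
def HasSeqClosedGraph {X : Type*} [TopologicalSpace X] (F : X → Set X) : Prop :=
  ∀ (x y : ℕ → X) (a b : X), Tendsto x atTop (𝓝 a) →
    (∀ n, y n ∈ F (x n)) → Tendsto y atTop (𝓝 b) → b ∈ F a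

theorem mem_setImage {X : Type*} {F : X → Set X} {A : Set X} {y : X} :
    y ∈ setImage F A ↔ ∃ x ∈ A, y ∈ F x := by
  simp [setImage]

theorem setImage_mono {X : Type*} (F : X → Set X) : Monotone (setImage F) :=
  fun _ _ h => biUnion_subset_biUnion_left h

theorem setImage_nonempty {X : Type*} {F : X → Set X} (hne : ∀ x, (F x).Nonempty)
    {A : Set X} (hA : A.Nonempty) : (setImage F A).Nonempty := by
  obtain ⟨x, hx⟩ := hA
  obtain ⟨y, hy⟩ := hne x
  exact ⟨y, mem_setImage.2 ⟨x, hx, hy⟩⟩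

section

variable {X : Type*} [MetricSpace X] [CompactSpace X] {F : X → Set X}

theorem HasSeqClosedGraph.isClosed_setImage (hF : HasSeqClosedGraph F) {A : Set X}
    (hA : IsClosed A) : IsClosed (setImage F A) := by
  refine IsSeqClosed.isClosed fun y b hy hb => ?_
  choose x hxA hxy using fun n => mem_setImage.1 (hy n)
  obtain ⟨a, ha, φ, hφ, hlim⟩ := hA.isCompact.tendsto_subseq hxA
  exact mem_setImage.2 ⟨a, ha, hF _ _ a b hlim (fun n => hxy (φ n)) (hb.comp hφ.tendsto_atTop)⟩

theorem HasSeqClosedGraph.setImage_iInter (hF : HasSeqClosedGraph F) {K : ℕ → Set X}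
    (hK : Antitone K) (hc : ∀ n, IsClosed (K n)) :
    setImage F (⋂ n, K n) = ⋂ n, setImage F (K n) := by
  refine Subset.antisymm (subset_iInter fun n => setImage_mono F (iInter_subset K n)) ?_
  intro y hy
  choose x hxK hxy using fun n => mem_setImage.1 (mem_iInter.1 hy n)
  obtain ⟨a, -, φ, hφ, hlim⟩ := isCompact_univ.tendsto_subseq fun n => mem_univ (x n)
  refine mem_setImage.2 ⟨a, mem_iInter.2 fun n => ?_,
    hF _ (fun _ => y) a y hlim (fun n => hxy (φ n)) tendsto_const_nhds⟩
  refine (hc n).mem_of_tendsto hlim ?_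
  filter_upwards [eventually_ge_atTop n] with m hm
  exact hK (hm.trans hφ.le_apply) (hxK (φ m))

/-- Every nonempty closed forward-invariant set contains a nonempty compact invariant set. -/
theorem HasSeqClosedGraph.exists_invariant_subset (hF : HasSeqClosedGraph F)
    (hne : ∀ x, (F x).Nonempty) {K : Set X} (hK : K.Nonempty) (hc : IsClosed K)
    (hsub : setImage F K ⊆ K) :
    ∃ L ⊆ K, L.Nonempty ∧ IsCompact L ∧ setImage F L = L := by
  have hanti : Antitone fun n => (setImage F)^[n] K :=
    (setImage_mono F).antitone_iterate_of_map_le hsub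
  have hclosed : ∀ n, IsClosed ((setImage F)^[n] K) := by
    intro n
    induction n with
    | zero => exact hc
    | succ n ih =>
      rw [Function.iterate_succ_apply']
      exact hF.isClosed_setImage ih
  have hnonempty : ∀ n, ((setImage F)^[n] K).Nonempty := by
    intro n
    induction n with
    | zero => exact hK
    | succ n ih =>
      rw [Function.iterate_succ_apply']
      exact setImage_nonempty hne ih
  refine ⟨⋂ n, (setImage F)^[n] K, iInter_subset _ 0, ?_,
    (isClosed_iInter hclosed).isCompact, ?_⟩
  · exact IsCompact.nonempty_iInter_of_sequence_nonempty_isCompact_isClosed _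
      (fun n => hanti n.le_succ) hnonempty hc.isCompact hclosed
  · rw [hF.setImage_iInter hanti hclosed]
    simp only [← Function.iterate_succ_apply']
    exact hanti.iInter_nat_add 1

theorem IsMinimalInvariant.subset_of_forward_invariant {M : Set X}
    (hM : IsMinimalInvariant F M) (hF : HasSeqClosedGraph F) (hne : ∀ x, (F x).Nonempty)
    {K : Set X} (hK : K.Nonempty) (hc : IsClosed K) (hsub : setImage F K ⊆ K) (hKM : K ⊆ M) :
    M ⊆ K := by
  obtain ⟨L, hLK, hL, hLc, hLF⟩ := hF.exists_invariant_subset hne hK hc hsub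
  by_contra hMK
  exact hM.2.2.2 L ⟨hLK.trans hKM, fun h => hMK (h.trans hLK)⟩ hL hLc hLF

theorem IsMinimalInvariant.eq_of_mem {M N : Set X} (hM : IsMinimalInvariant F M)
    (hN : IsMinimalInvariant F N) (hF : HasSeqClosedGraph F) (hne : ∀ x, (F x).Nonempty)
    {x : X} (hxM : x ∈ M) (hxN : x ∈ N) : M = N := by
  have hc : IsClosed (M ∩ N) := hM.2.1.isClosed.inter hN.2.1.isClosed
  have hsub : setImage F (M ∩ N) ⊆ M ∩ N := subset_inter
    ((setImage_mono F inter_subset_left).trans hM.2.2.1.subset)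
    ((setImage_mono F inter_subset_right).trans hN.2.2.1.subset)
  have hK : (M ∩ N).Nonempty := ⟨x, hxM, hxN⟩
  exact Subset.antisymm
    ((hM.subset_of_forward_invariant hF hne hK hc hsub inter_subset_left).trans inter_subset_right)
    ((hN.subset_of_forward_invariant hF hne hK hc hsub inter_subset_right).trans inter_subset_left)

end


/-- If some iterate `F^T({x})` contains a ball of uniform radius `ε > 0`
for every `x`, then there are only finitely many minimal `F`-invariant sets. -/
theorem finitely_many_minimal_invariant {X : Type*} [MetricSpace X] [CompactSpace X]
    (F : X → Set X)
    (hne : ∀ x, (F x).Nonempty)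
    (hcpt : ∀ x, IsCompact (F x))
    (husc : ∀ (x y : ℕ → X) (a b : X), Tendsto x atTop (𝓝 a) →
      (∀ n, y n ∈ F (x n)) → Tendsto y atTop (𝓝 b) → b ∈ F a)
    (T : ℕ) (hT : 1 ≤ T) (ε : ℝ) (hε : 0 < ε)
    (hball : ∀ x : X, ∃ c : X, ball c ε ⊆ (setImage F)^[T] {x}) :
    {M : Set X | IsMinimalInvariant F M}.Finite := by
  obtain ⟨s, -, hs, hcover⟩ := finite_cover_balls_of_compact (isCompact_univ (X := X)) hε
  refine (hs.biUnion (t := fun t => {M | IsMinimalInvariant F M ∧ t ∈ M}) fun t _ =>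
    Set.Subsingleton.finite fun M hM N hN =>
      hM.1.eq_of_mem hN.1 husc hne hM.2 hN.2).subset fun M hM => ?_
  obtain ⟨x, hx⟩ := hM.1
  obtain ⟨c, hcx⟩ := hball x
  have hsub : (setImage F)^[T] {x} ⊆ M := by
    rw [← Function.iterate_fixed hM.2.2.1 T]
    exact (setImage_mono F).iterate T (singleton_subset_iff.2 hx)
  obtain ⟨t, hts, hct⟩ := mem_iUnion₂.1 (hcover (mem_univ c))
  exact mem_iUnion₂.2 ⟨t, hts, hM, hsub (hcx (mem_ball_comm.1 hct))⟩
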